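/- Consider the input A for the team power game with 3 teams and 2 time slots given by A = [[2,2],[1,2],[3,2]] (team 1 has true availabilities (2,2), team 2 has (1,2), team 3 has (3,2)), and the strategy profile B' = [[2,2],[1,2],[3,0]]. Then B' is a 1-strong Nash equilibrium for A (no single team has an improvement step with respect to B'), but B' is not a 2-strong Nash equilibrium for A: the coalition {team 1, team 2} has an improvement step with respect to B', obtained by both teams declaring availabilities (0,2). -/

import Mathlib

open Finset

section TPG

variable {T C : Type*} [Fintype T] [Fintype C] [DecidableEq T] [DecidableEq C]

/-- Sum of declared availabilities at a time slot. -/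
def colSum (B : T → C → ℕ) (j : C) : ℕ := ∑ i, B i j

/-- Winning time slots: those maximizing the column sum. -/
def winners (B : T → C → ℕ) : Finset C :=
  Finset.univ.filter fun j => ∀ j', colSum B j' ≤ colSum B j

/-- Relative power of team `i` at slot `j` (0 when the denominator is 0). -/
def power (B : T → C → ℕ) (i : T) (j : C) : ℚ :=
  (B i j : ℚ) / (colSum B j : ℚ)

/-- Pay-off of team `i`: minimum relative power over all winning slots. -/
def payoff (B : T → C → ℕ) (i : T) : ℚ :=
  if h : (winners B).Nonempty then (winners B).inf' h (power B i) else 0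

/-- `B` is a strategy profile for input `A`. -/
def IsProfile (A B : T → C → ℕ) : Prop := ∀ i j, B i j ≤ A i j

/-- `D` is an improvement step for coalition `S` with respect to `B` (for input `A`). -/
def IsImprovement (A B : T → C → ℕ) (S : Finset T) (D : T → C → ℕ) : Prop :=
  IsProfile A D ∧ (∀ i ∉ S, ∀ j, D i j = B i j) ∧ ∀ i ∈ S, payoff B i < payoff D i

/-- `B` is a `t`-strong Nash equilibrium for `A`. -/
def IsStrongNash (t : ℕ) (A B : T → C → ℕ) : Prop :=
  IsProfile A B ∧
    ∀ S : Finset T, S.Nonempty → S.card ≤ t → ∀ D, ¬ IsImprovement A B S D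

end TPG

section

variable {T C : Type*} [Fintype T]

theorem mem_winners [Fintype C] {B : T → C → ℕ} {j : C} :
    j ∈ winners B ↔ ∀ j', colSum B j' ≤ colSum B j := by
  simp [winners]

theorem payoff_le_power [Fintype C] {B : T → C → ℕ} {j : C} (hj : j ∈ winners B) (i : T) :
    payoff B i ≤ power B i j := by
  rw [payoff, dif_pos ⟨j, hj⟩]
  exact Finset.inf'_le _ hj

theorem payoff_eq_power [Fintype C] {B : T → C → ℕ} {j : C} (hj : winners B = {j}) (i : T) :
    payoff B i = power B i j := by
  simp [payoff, hj]

theorem winners_nonempty [Fintype C] [Nonempty C] (B : T → C → ℕ) : (winners B).Nonempty := by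
  obtain ⟨j, hj⟩ := Finite.exists_max (colSum B)
  exact ⟨j, mem_winners.2 hj⟩

/-- A team declaring at most a fraction `p / q` of the total at a slot has relative power at most
`p / q` there. -/
theorem power_le_div {B : T → C → ℕ} {i : T} {j : C} {p q : ℕ} (hq : 0 < q)
    (h : B i j * q ≤ p * colSum B j) : power B i j ≤ (p : ℚ) / q := by
  have hq' : (0 : ℚ) < q := by exact_mod_cast hq
  rcases Nat.eq_zero_or_pos (colSum B j) with h0 | h0
  · rw [power, h0, Nat.cast_zero, div_zero]
    positivity
  · have h0' : (0 : ℚ) < colSum B j := by exact_mod_cast h0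
    rw [power, div_le_div_iff₀ h0' hq']
    exact_mod_cast h

end

/-- For the input `A = [[2,2],[1,2],[3,2]]`, the profile `B' = [[2,2],[1,2],[3,0]]`
is a 1-strong Nash equilibrium but not a 2-strong one: the coalition of teams 1 and 2
improves by both declaring `(0,2)` (team 3 keeping `(3,0)`). -/
theorem illustrating_example :
    IsStrongNash 1 (![![2, 2], ![1, 2], ![3, 2]] : Fin 3 → Fin 2 → ℕ)
        ![![2, 2], ![1, 2], ![3, 0]] ∧
    ¬ IsStrongNash 2 (![![2, 2], ![1, 2], ![3, 2]] : Fin 3 → Fin 2 → ℕ)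
        ![![2, 2], ![1, 2], ![3, 0]] ∧
    IsImprovement (![![2, 2], ![1, 2], ![3, 2]] : Fin 3 → Fin 2 → ℕ)
        ![![2, 2], ![1, 2], ![3, 0]]
        ({0, 1} : Finset (Fin 3)) ![![0, 2], ![0, 2], ![3, 0]] := by
  have hB : winners (![![2, 2], ![1, 2], ![3, 0]] : Fin 3 → Fin 2 → ℕ) = {0} := by decide
  have hD : winners (![![0, 2], ![0, 2], ![3, 0]] : Fin 3 → Fin 2 → ℕ) = {1} := by decide
  have hB6 : colSum (![![2, 2], ![1, 2], ![3, 0]] : Fin 3 → Fin 2 → ℕ) 0 = 6 := by decide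
  have hD4 : colSum (![![0, 2], ![0, 2], ![3, 0]] : Fin 3 → Fin 2 → ℕ) 1 = 4 := by decide
  have himp : IsImprovement (![![2, 2], ![1, 2], ![3, 2]] : Fin 3 → Fin 2 → ℕ)
      ![![2, 2], ![1, 2], ![3, 0]]
      ({0, 1} : Finset (Fin 3)) ![![0, 2], ![0, 2], ![3, 0]] := by
    refine ⟨by unfold IsProfile; decide, by decide, fun i hi => ?_⟩
    rw [payoff_eq_power hB, payoff_eq_power hD]
    fin_cases i
    · norm_num [power, hB6, hD4]
    · norm_num [power, hB6, hD4]
    · simp at hi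
  refine ⟨⟨by unfold IsProfile; decide, ?_⟩,
    fun h => h.2 {0, 1} (by simp) (by simp) _ himp, himp⟩
  rintro S hS hcard D ⟨hprof, hfix, hlt⟩
  obtain ⟨i, rfl⟩ := Finset.card_eq_one.1 (le_antisymm hcard hS.card_pos)
  have hlt := hlt i (Finset.mem_singleton_self i)
  rw [payoff_eq_power hB] at hlt
  simp only [Finset.mem_singleton] at hfix
  have hsum (j : Fin 2) : colSum D j = D 0 j + D 1 j + D 2 j := Fin.sum_univ_three _
  have hp0 := hprof i 0
  have hp1 := hprof i 1
  refine hlt.not_ge ?_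
  fin_cases i
  · have h10 := hfix 1 (by decide) 0
    have h11 := hfix 1 (by decide) 1
    have h20 := hfix 2 (by decide) 0
    have h21 := hfix 2 (by decide) 1
    simp at hp0 hp1 h10 h11 h20 h21
    have hw : (0 : Fin 2) ∈ winners D := by
      simp only [mem_winners, Fin.forall_fin_two, hsum]
      omega
    refine (payoff_le_power hw 0).trans ((power_le_div (p := 1) (q := 3) (by simp) ?_).trans ?_)
    · rw [hsum]
      omega
    · norm_num [power, hB6]
  · have h00 := hfix 0 (by decide) 0
    have h01 := hfix 0 (by decide) 1
    have h20 := hfix 2 (by decide) 0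
    have h21 := hfix 2 (by decide) 1
    simp at hp0 hp1 h00 h01 h20 h21
    have hw : (0 : Fin 2) ∈ winners D := by
      simp only [mem_winners, Fin.forall_fin_two, hsum]
      omega
    refine (payoff_le_power hw 1).trans ((power_le_div (p := 1) (q := 6) (by simp) ?_).trans ?_)
    · rw [hsum]
      omega
    · norm_num [power, hB6]
  · have h00 := hfix 0 (by decide) 0
    have h01 := hfix 0 (by decide) 1
    have h10 := hfix 1 (by decide) 0
    have h11 := hfix 1 (by decide) 1
    simp at hp0 hp1 h00 h01 h10 h11
    obtain ⟨j, hw⟩ := winners_nonempty D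
    refine (payoff_le_power hw 2).trans ((power_le_div (p := 1) (q := 2) (by simp) ?_).trans ?_)
    · rw [hsum]
      fin_cases j <;> simp <;> omega
    · norm_num [power, hB6]
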